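/- Let n ≥ 3 and let ℓ ∈ ℝⁿ be generic with ℓ_1 ≤ ℓ_2 ≤ … ≤ ℓ_{n−1}, all ℓ_i > 0, and ℓ_n < ℓ_{n−1}. Then for every k with 0 ≤ k ≤ n−2, the difference α_k(ℓ) − β_k(ℓ, ℓ) equals the number of subsets K ⊆ {1,…,n} of cardinality k+1 which contain the index n−1 (the index of a longest link) and are short with respect to ℓ. (Here β_k(ℓ, ℓ) denotes the number of subsets J ⊆ {1,…,n−2} of cardinality n−k−2 such that J∪{n} is short with respect to ℓ and J∪{n−1} is long with respect to ℓ.) -/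

import Mathlib

open Finset
open scoped Classical

noncomputable section

/-- `dsum ℓ J = ∑_{i ∈ J} ℓ i − ∑_{i ∉ J} ℓ i`. -/
def dsum {n : ℕ} (ℓ : Fin n → ℝ) (J : Finset (Fin n)) : ℝ :=
  ∑ i ∈ J, ℓ i - ∑ i ∈ Jᶜ, ℓ i

/-- `J` is long with respect to `ℓ`. -/
def IsLong {n : ℕ} (ℓ : Fin n → ℝ) (J : Finset (Fin n)) : Prop := 0 < dsum ℓ J

/-- `J` is short with respect to `ℓ`. -/
def IsShort {n : ℕ} (ℓ : Fin n → ℝ) (J : Finset (Fin n)) : Prop := dsum ℓ J < 0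

/-- `ℓ` is generic: `s_J(ℓ) ≠ 0` for every subset `J`. -/
def Generic {n : ℕ} (ℓ : Fin n → ℝ) : Prop := ∀ J : Finset (Fin n), dsum ℓ J ≠ 0

/-- `alphaNum ℓ k` is the number of subsets `J ⊆ {1,…,n−1}` (in zero-based indexing:
subsets of `Fin n` avoiding the last index, which corresponds to the telescopic leg `n`)
of cardinality `n − k − 1` which are long with respect to `ℓ`.  The cardinality condition
is stated over `ℤ`, so that `alphaNum ℓ j = 0` for `j` outside the range `0 ≤ j ≤ n − 2`. -/
def alphaNum {n : ℕ} (ℓ : Fin n → ℝ) (k : ℤ) : ℕ :=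
  (univ.filter (fun J : Finset (Fin n) =>
    (∀ i ∈ J, (i : ℕ) + 1 < n) ∧ (J.card : ℤ) = (n : ℤ) - k - 1 ∧ IsLong ℓ J)).card

/-- `betaNum ℓp ℓm k` is the number of subsets `J ⊆ {1,…,n−2}` of cardinality `n − k − 2`
such that `J ∪ {n}` is short with respect to `ℓp` and `J ∪ {n−1}` is long with respect
to `ℓm` (zero-based: the paper's index `n` is the last index of `Fin n`, i.e. the unique
`i` with `i + 1 = n`, and the paper's `n − 1` is the unique `i` with `i + 2 = n`). -/
def betaNum {n : ℕ} (ℓp ℓm : Fin n → ℝ) (k : ℤ) : ℕ :=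
  (univ.filter (fun J : Finset (Fin n) =>
    (∀ i ∈ J, (i : ℕ) + 2 < n) ∧ (J.card : ℤ) = (n : ℤ) - k - 2 ∧
    IsShort ℓp (J ∪ univ.filter (fun i : Fin n => (i : ℕ) + 1 = n)) ∧
    IsLong ℓm (J ∪ univ.filter (fun i : Fin n => (i : ℕ) + 2 = n)))).card

end
theorem dsum_compl {n : ℕ} (ℓ : Fin n → ℝ) (J : Finset (Fin n)) :
    dsum ℓ Jᶜ = -dsum ℓ J := by
  simp [dsum]

theorem isLong_compl {n : ℕ} (ℓ : Fin n → ℝ) (J : Finset (Fin n)) :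
    IsLong ℓ Jᶜ ↔ IsShort ℓ J := by
  simp [IsLong, IsShort, dsum_compl]

theorem isShort_compl {n : ℕ} (ℓ : Fin n → ℝ) (J : Finset (Fin n)) :
    IsShort ℓ Jᶜ ↔ IsLong ℓ J := by
  simp [IsLong, IsShort, dsum_compl]

theorem Generic.isLong_iff_not_isShort {n : ℕ} {ℓ : Fin n → ℝ} (h : Generic ℓ)
    (J : Finset (Fin n)) : IsLong ℓ J ↔ ¬ IsShort ℓ J := by
  rw [IsLong, IsShort, not_lt]
  exact ⟨le_of_lt, fun h' => lt_of_le_of_ne h' (h J).symm⟩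

theorem dsum_le_dsum_of_sum_le {n : ℕ} {ℓ : Fin n → ℝ} {J K : Finset (Fin n)}
    (h : ∑ i ∈ J, ℓ i ≤ ∑ i ∈ K, ℓ i) : dsum ℓ J ≤ dsum ℓ K := by
  have hJ := Finset.sum_add_sum_compl J ℓ
  have hK := Finset.sum_add_sum_compl K ℓ
  unfold dsum
  linarith

/-- The image of a set of indices under the transposition of `a` and `b`. -/
def swapSet {n : ℕ} (a b : Fin n) (K : Finset (Fin n)) : Finset (Fin n) :=
  K.map (Equiv.swap a b).toEmbedding

theorem mem_swapSet {n : ℕ} {a b i : Fin n} {K : Finset (Fin n)} :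
    i ∈ swapSet a b K ↔ Equiv.swap a b i ∈ K := by
  rw [swapSet, Finset.mem_map_equiv, Equiv.symm_swap]

theorem swapSet_swapSet {n : ℕ} (a b : Fin n) (K : Finset (Fin n)) :
    swapSet a b (swapSet a b K) = K := by
  ext i
  simp [mem_swapSet]

theorem card_swapSet {n : ℕ} (a b : Fin n) (K : Finset (Fin n)) :
    (swapSet a b K).card = K.card := by
  simp [swapSet]

theorem swapSet_eq_self {n : ℕ} {a b : Fin n} {K : Finset (Fin n)}
    (ha : a ∈ K) (hb : b ∈ K) : swapSet a b K = K := by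
  ext i
  rw [mem_swapSet, Equiv.swap_apply_def]
  split_ifs <;> simp_all

theorem dsum_le_dsum_swapSet {n : ℕ} {ℓ : Fin n → ℝ} {a b : Fin n} (hab : ℓ a ≤ ℓ b)
    {K : Finset (Fin n)} (ha : a ∈ K) : dsum ℓ K ≤ dsum ℓ (swapSet a b K) := by
  by_cases hb : b ∈ K
  · rw [swapSet_eq_self ha hb]
  · apply dsum_le_dsum_of_sum_le
    rw [swapSet, Finset.sum_map]
    refine Finset.sum_le_sum fun i hi => ?_
    rw [Equiv.coe_toEmbedding, Equiv.swap_apply_def]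
    split_ifs with h1 h2
    · rwa [h1]
    · exact absurd (h2 ▸ hi) hb
    · exact le_rfl

theorem compl_insert_eq_swapSet {n : ℕ} {a b : Fin n} {J : Finset (Fin n)}
    (ha : a ∉ J) (hb : b ∉ J) : (insert a J)ᶜ = swapSet a b (insert b J)ᶜ := by
  ext i
  rw [mem_swapSet, Equiv.swap_apply_def]
  split_ifs <;> simp_all [eq_comm]

theorem intCast_card_compl {n : ℕ} (J : Finset (Fin n)) : (Jᶜ.card : ℤ) = n - J.card := by
  rw [Finset.card_compl, Fintype.card_fin, Nat.cast_sub (by simpa using J.card_le_univ)]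

theorem alphaNum_eq_card_isShort {n : ℕ} (ℓ : Fin n → ℝ) {a : Fin n} (ha : (a : ℕ) + 1 = n)
    (k : ℤ) : alphaNum ℓ k = (univ.filter (fun K : Finset (Fin n) =>
      (K.card : ℤ) = k + 1 ∧ a ∈ K ∧ IsShort ℓ K)).card := by
  have hmem (J : Finset (Fin n)) : (∀ i ∈ J, (i : ℕ) + 1 < n) ↔ a ∉ J := by
    refine ⟨fun h h' => by have := h a h'; omega, fun h i hi => ?_⟩
    have : i ≠ a := fun e => h (e ▸ hi)
    have := Fin.val_ne_of_ne this
    omega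
  refine Finset.card_nbij' (fun J => Jᶜ) (fun K => Kᶜ) ?_ ?_ ?_ ?_
  · intro J
    simp only [coe_filter, mem_univ, true_and, Set.mem_ofPred_eq, hmem, intCast_card_compl, isShort_compl,
      mem_compl]
    rintro ⟨h1, h2, h3⟩
    exact ⟨by omega, h1, h3⟩
  · intro K
    simp only [coe_filter, mem_univ, true_and, Set.mem_ofPred_eq, hmem, intCast_card_compl, isLong_compl,
      mem_compl, not_not]
    rintro ⟨h1, h2, h3⟩
    exact ⟨h2, by omega, h3⟩
  · intro J _
    simp
  · intro K _
    simp

theorem betaNum_eq_card_not_isShort_swapSet {n : ℕ} {ℓ : Fin n → ℝ} (hgen : Generic ℓ)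
    {a b : Fin n} (ha : (a : ℕ) + 1 = n) (hb : (b : ℕ) + 2 = n) (k : ℤ) :
    betaNum ℓ ℓ k = (univ.filter (fun K : Finset (Fin n) =>
      ((K.card : ℤ) = k + 1 ∧ a ∈ K ∧ IsShort ℓ K) ∧ ¬ IsShort ℓ (swapSet a b K))).card := by
  have hab : a ≠ b := fun e => by rw [e] at ha; omega
  have hmem (J : Finset (Fin n)) : (∀ i ∈ J, (i : ℕ) + 2 < n) ↔ a ∉ J ∧ b ∉ J := by
    refine ⟨fun h => ⟨fun h' => by have := h a h'; omega, fun h' => by have := h b h'; omega⟩,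
      fun h i hi => ?_⟩
    have h1 := Fin.val_ne_of_ne (fun e => h.1 (e ▸ hi) : i ≠ a)
    have h2 := Fin.val_ne_of_ne (fun e => h.2 (e ▸ hi) : i ≠ b)
    omega
  have hfa (J : Finset (Fin n)) :
      J ∪ univ.filter (fun i : Fin n => (i : ℕ) + 1 = n) = insert a J := by
    ext i
    simp only [mem_union, mem_filter, mem_univ, true_and, mem_insert, Fin.ext_iff]
    rw [or_comm]
    refine or_congr_left ?_
    omega
  have hfb (J : Finset (Fin n)) :
      J ∪ univ.filter (fun i : Fin n => (i : ℕ) + 2 = n) = insert b J := by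
    ext i
    simp only [mem_union, mem_filter, mem_univ, true_and, mem_insert, Fin.ext_iff]
    rw [or_comm]
    refine or_congr_left ?_
    omega
  unfold betaNum
  simp only [hmem, hfa, hfb]
  refine Finset.card_nbij' (fun J => (insert b J)ᶜ) (fun K => (insert b K)ᶜ) ?_ ?_ ?_ ?_
  · intro J
    simp only [coe_filter, mem_univ, true_and, Set.mem_ofPred_eq]
    rintro ⟨⟨haJ, hbJ⟩, h2, h3, h4⟩
    rw [← compl_insert_eq_swapSet haJ hbJ, ← hgen.isLong_iff_not_isShort, isLong_compl,
      isShort_compl, intCast_card_compl, card_insert_of_notMem hbJ]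
    refine ⟨⟨by push_cast; omega, by simp [haJ, hab], h4⟩, h3⟩
  · intro K
    simp only [coe_filter, mem_univ, true_and, Set.mem_ofPred_eq]
    rintro ⟨⟨h1, haK, h3⟩, h4⟩
    have hbK : b ∉ K := fun h => h4 (by rwa [swapSet_eq_self haK h])
    have haJ : a ∉ (insert b K)ᶜ := by simp [haK]
    have hbJ : b ∉ (insert b K)ᶜ := by simp
    have hins : insert b (insert b K)ᶜ = Kᶜ := by
      ext i
      by_cases hi : i = b <;> simp_all
    refine ⟨⟨haJ, hbJ⟩, ?_, ?_, ?_⟩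
    · rw [intCast_card_compl, card_insert_of_notMem hbK]
      push_cast
      omega
    · rw [← isLong_compl, compl_insert_eq_swapSet haJ hbJ, hins, compl_compl,
        hgen.isLong_iff_not_isShort]
      exact h4
    · rwa [hins, isLong_compl]
  · intro J
    simp only [coe_filter, mem_univ, true_and, Set.mem_ofPred_eq]
    rintro ⟨⟨-, hbJ⟩, -⟩
    ext i
    by_cases hi : i = b <;> simp_all
  · intro K
    simp only [coe_filter, mem_univ, true_and, Set.mem_ofPred_eq]
    rintro ⟨⟨-, haK, h3⟩, h4⟩
    have hbK : b ∉ K := fun h => h4 (by rwa [swapSet_eq_self haK h])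
    ext i
    by_cases hi : i = b <;> simp_all

theorem card_isShort_eq_card_isShort_swapSet {n : ℕ} {ℓ : Fin n → ℝ} {a b : Fin n}
    (hab : ℓ a ≤ ℓ b) (k : ℤ) :
    (univ.filter (fun K : Finset (Fin n) => (K.card : ℤ) = k ∧ b ∈ K ∧ IsShort ℓ K)).card =
      (univ.filter (fun K : Finset (Fin n) =>
        ((K.card : ℤ) = k ∧ a ∈ K ∧ IsShort ℓ K) ∧ IsShort ℓ (swapSet a b K))).card := by
  refine Finset.card_nbij' (swapSet a b) (swapSet a b) ?_ ?_
    (fun K _ => swapSet_swapSet a b K) (fun K _ => swapSet_swapSet a b K)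
  · intro K
    simp only [coe_filter, mem_univ, true_and, Set.mem_ofPred_eq, card_swapSet, swapSet_swapSet]
    rintro ⟨h1, h2, h3⟩
    have ha : a ∈ swapSet a b K := by simpa [mem_swapSet] using h2
    refine ⟨⟨h1, ha, ?_⟩, h3⟩
    have := dsum_le_dsum_swapSet hab ha
    rw [swapSet_swapSet] at this
    exact this.trans_lt h3
  · intro K
    simp only [coe_filter, mem_univ, true_and, Set.mem_ofPred_eq, card_swapSet]
    rintro ⟨⟨h1, h2, -⟩, h4⟩
    exact ⟨h1, by simpa [mem_swapSet] using h2, h4⟩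

/-- For a generic length vector `ℓ` with `ℓ_1 ≤ … ≤ ℓ_{n−1}` and `ℓ_n < ℓ_{n−1}`,
the difference `α_k(ℓ) − β_k(ℓ, ℓ)` equals the number of subsets `K ⊆ {1,…,n}` of
cardinality `k + 1` which contain the index `n − 1` (the index of a longest link,
zero-based: the unique `i` with `i + 2 = n`) and are short with respect to `ℓ`. -/
theorem stmt_7 (n : ℕ) (hn : 3 ≤ n) (ℓ : Fin n → ℝ)
    (hpos : ∀ i : Fin n, 0 < ℓ i)
    (hmono : ∀ i j : Fin n, i ≤ j → (j : ℕ) + 1 < n → ℓ i ≤ ℓ j)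
    (hlast : ℓ ⟨n - 1, by omega⟩ < ℓ ⟨n - 2, by omega⟩)
    (hgen : Generic ℓ)
    (k : ℕ) (hk : k ≤ n - 2) :
    (alphaNum ℓ (k : ℤ) : ℤ) - (betaNum ℓ ℓ (k : ℤ) : ℤ) =
      ((univ.filter (fun K : Finset (Fin n) =>
        (K.card : ℤ) = (k : ℤ) + 1 ∧ (∃ i ∈ K, (i : ℕ) + 2 = n) ∧ IsShort ℓ K)).card : ℤ) := by
  obtain ⟨a, b, ha, hb, hab⟩ :
      ∃ a b : Fin n, (a : ℕ) + 1 = n ∧ (b : ℕ) + 2 = n ∧ ℓ a < ℓ b :=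
    ⟨_, _, Nat.sub_add_cancel (by omega), Nat.sub_add_cancel (by omega), hlast⟩
  have hmem (K : Finset (Fin n)) : (∃ i ∈ K, (i : ℕ) + 2 = n) ↔ b ∈ K := by
    refine ⟨fun ⟨i, hi, h⟩ => ?_, fun h => ⟨b, h, hb⟩⟩
    rwa [show b = i from Fin.ext (by omega)]
  simp only [hmem]
  rw [alphaNum_eq_card_isShort ℓ ha, betaNum_eq_card_not_isShort_swapSet hgen ha hb,
    card_isShort_eq_card_isShort_swapSet hab.le, sub_eq_iff_eq_add]
  have h := Finset.card_filter_add_card_filter_not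
    (s := univ.filter fun K : Finset (Fin n) => (K.card : ℤ) = k + 1 ∧ a ∈ K ∧ IsShort ℓ K)
    (fun K => IsShort ℓ (swapSet a b K))
  rw [Finset.filter_filter, Finset.filter_filter] at h
  exact_mod_cast h.symm
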